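/- Let X be a real random variable with absolutely continuous density p satisfying E[|X|/(1+X^2)] < ∞. If E[(it - 2X/(1+X^2)) exp(itX)] = 0 for all t ∈ ℝ, then p satisfies the ODE p'(x) + (2x/(1+x^2)) p(x) = 0 for almost all x, and consequently p(x) = 1/(π(1+x^2)), i.e. X ~ C(0,1). -/

import Mathlib

open MeasureTheory Real Complex

open scoped FourierTransform SchwartzMap ContDiff in
lemma aux_fourier (P G : ℝ → ℂ) (hP : Integrable P) (hG : Integrable G)
    (h : ∀ s : ℝ, (-2 * π * I * s) * 𝓕 P s = 𝓕 G s) (S : 𝓢(ℝ, ℂ)) :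
    ∫ x, P x * deriv S x = ∫ x, G x * S x := by
  set ψ : 𝓢(ℝ, ℂ) := 𝓕⁻ S with hψ
  have hS : 𝓕 ψ = S := FourierTransform.fourier_fourierInv_eq S
  have hS' : (S : ℝ → ℂ) = 𝓕 (ψ : ℝ → ℂ) := by
    rw [← SchwartzMap.fourier_coe, hS]
  have hi : Integrable (fun x : ℝ => x • ψ x) := by
    refine (ψ.integrable_pow_mul volume 1).mono' (by fun_prop) ?_
    filter_upwards with x
    simp
  have hi2 : Integrable (fun x : ℝ => (-2 * π * I * x) • ψ x) := by
    refine (hi.const_mul (-2 * π * I)).congr ?_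
    filter_upwards with x
    simp
    ring
  have key : ∀ (F ξ : ℝ → ℂ), Integrable F → Integrable ξ →
      ∫ x, F x * 𝓕 ξ x = ∫ x, 𝓕 F x * ξ x := by
    intro F ξ hF hξ
    simpa using! (VectorFourier.integral_fourierIntegral_smul_eq_flip (L := innerₗ ℝ)
      Real.continuous_fourierChar continuous_inner hF hξ).symm
  rw [hS', Real.deriv_fourier ψ.integrable hi, key _ _ hP hi2, key _ _ hG ψ.integrable]
  congr 1
  ext x
  rw [← h x, smul_eq_mul]
  ring

open scoped ContDiff in
lemma aux_parts (p p' : ℝ → ℝ)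
    (hac : ∀ a b : ℝ, p b - p a = ∫ x in a..b, p' x)
    (hp'int : LocallyIntegrable p' volume) (χ : ℝ → ℝ) (h1 : ContDiff ℝ ∞ χ)
    (h2 : HasCompactSupport χ) :
    ∫ x, p x * deriv χ x = - ∫ x, χ x * p' x := by
  obtain ⟨R, hR⟩ := h2.isCompact.isBounded.subset_closedBall 0
  have hsub : ∀ x, χ x ≠ 0 ∨ deriv χ x ≠ 0 → x ∈ Set.Ioc (-(|R|+1)) (|R|+1) := by
    intro x hx
    have hx' : x ∈ tsupport χ := by
      rcases hx with hx | hx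
      · exact subset_tsupport _ hx
      · exact support_deriv_subset hx
    have := hR hx'
    rw [Metric.mem_closedBall, Real.dist_eq, sub_zero] at this
    have h3 := abs_le.1 (this.trans (le_abs_self R))
    constructor <;> linarith [h3.1, h3.2]
  set b := |R| + 1 with hb
  have hI : IntervalIntegrable p' volume (-b) b :=
    (hp'int.integrableOn_isCompact isCompact_uIcc).intervalIntegrable
  have hpe : p = fun x => (∫ t in (-b)..x, p' t) + p (-b) := by
    ext x
    linarith [hac (-b) x]
  have hb0 : 0 < b := by positivity
  have hcont : Continuous p := by
    rw [hpe]
    refine (intervalIntegral.continuous_primitive (fun u v => ?_) _).add continuous_const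
    exact (hp'int.integrableOn_isCompact isCompact_uIcc).intervalIntegrable
  have hA : AbsolutelyContinuousOnInterval p (-b) b := by
    rw [hpe]
    refine (hI.absolutelyContinuousOnInterval_intervalIntegral (by simp)).fun_add ?_
    exact (contDiffOn_const (n := 1)).absolutelyContinuousOnInterval
  have hB : AbsolutelyContinuousOnInterval χ (-b) b :=
    (h1.of_le (by simp)).contDiffOn.absolutelyContinuousOnInterval
  have hIP := hA.integral_mul_deriv_eq_deriv_mul hB
  have hd : ∀ᵐ x, deriv p x = p' x := by
    filter_upwards [LocallyIntegrable.ae_hasDerivAt_integral hp'int] with x hx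
    have := ((hx (-b)).add_const (p (-b))).deriv
    rw [← this]
    congr 1
  have hχb : χ (b) = 0 ∧ χ (-b) = 0 := by
    constructor
    · by_contra hne
      have h' : b ∈ tsupport χ := subset_tsupport _ hne
      have := hR h'
      rw [Metric.mem_closedBall, Real.dist_eq, sub_zero] at this
      have := (le_abs_self b).trans (this.trans (le_abs_self R))
      linarith
    · by_contra hne
      have := (hsub _ (Or.inl hne)).1
      linarith
  rw [hχb.1, hχb.2, intervalIntegral.integral_eq_integral_of_support_subset,
    intervalIntegral.integral_eq_integral_of_support_subset] at hIP
  · rw [hIP]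
    simp only [mul_zero, sub_zero, zero_sub]
    congr 1
    apply integral_congr_ae
    filter_upwards [hd] with x hx
    rw [hx, mul_comm]
  · intro x hx
    exact hsub x (Or.inl (right_ne_zero_of_mul hx))
  · intro x hx
    exact hsub x (Or.inr (right_ne_zero_of_mul hx))

open scoped FourierTransform SchwartzMap ContDiff in
theorem aux_ode (p p' : ℝ → ℝ) (hcont : Continuous p)
    (hac : ∀ a b : ℝ, p b - p a = ∫ x in a..b, p' x)
    (hp'int : LocallyIntegrable p' volume)
    (hint : Integrable p volume)
    (hmom : Integrable (fun x : ℝ => |x| / (1 + x ^ 2) * p x) volume)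
    (hchar : ∀ t : ℝ,
      ∫ x : ℝ, ((Complex.I * t - 2 * x / (1 + (x : ℂ) ^ 2)) * Complex.exp (Complex.I * t * x))
        * (p x : ℂ) = 0) :
    ∀ᵐ x : ℝ, p' x + 2 * x / (1 + x ^ 2) * p x = 0 := by
  have hne : ∀ x : ℝ, 1 + x ^ 2 ≠ 0 := fun x => by positivity
  have hgc : Continuous (fun x : ℝ => 2 * x / (1 + x ^ 2) * p x) :=
    (Continuous.div (by fun_prop) (by fun_prop) hne).mul hcont
  have hg : Integrable (fun x : ℝ => 2 * x / (1 + x ^ 2) * p x) := by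
    refine (hmom.norm.const_mul 2).mono' hgc.aestronglyMeasurable ?_
    filter_upwards with x
    simp only [norm_mul, norm_div, Real.norm_eq_abs, abs_abs, abs_two]
    apply le_of_eq
    ring
  have hP : Integrable (fun x => (p x : ℂ)) := hint.ofReal
  have hG : Integrable (fun x : ℝ => ((2 * x / (1 + x ^ 2) * p x : ℝ) : ℂ)) := hg.ofReal
  have hF : ∀ s : ℝ, (-2 * π * I * s) * 𝓕 (fun x => (p x : ℂ)) s
      = 𝓕 (fun x : ℝ => ((2 * x / (1 + x ^ 2) * p x : ℝ) : ℂ)) s := by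
    intro s
    have h0 := hchar (-2 * π * s)
    have iP := (Real.fourierIntegral_convergent_iff (μ := volume) s).2 hP
    have iG := (Real.fourierIntegral_convergent_iff (μ := volume) s).2 hG
    rw [← sub_eq_zero, Real.fourier_eq, Real.fourier_eq, ← integral_const_mul, ← integral_sub (iP.const_mul _) iG,
      ← h0]
    congr 1
    ext x
    simp only [Circle.smul_def, Real.fourierChar_apply, smul_eq_mul]
    have : cexp (2 * π * ((-(inner ℝ x s) : ℝ) : ℂ) * I) = cexp (I * ((-2 * π * s : ℝ) : ℂ) * x) := by
      congr 1
      simp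
      ring
    push_cast at this ⊢
    rw [this]
    ring
  refine ae_eq_zero_of_integral_contDiff_smul_eq_zero (hp'int.add hg.locallyIntegrable) ?_
  intro χ h1 h2
  have h1' : ContDiff ℝ ∞ (fun x => (χ x : ℂ)) := Complex.ofRealCLM.contDiff.comp h1
  have h2' : HasCompactSupport (fun x => (χ x : ℂ)) := h2.comp_left (g := Complex.ofReal) (by simp)
  have e := aux_fourier _ _ hP hG hF (h2'.toSchwartzMap h1')
  have e2 := aux_parts p p' hac hp'int χ h1 h2
  have hd : ∀ x, deriv (fun x => (χ x : ℂ)) x = ((deriv χ x : ℝ) : ℂ) := fun x =>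
    ((h1.differentiable (by simp)) x).hasDerivAt.ofReal_comp.deriv
  have e3 : ∫ x, p x * deriv χ x = ∫ x, 2 * x / (1 + x ^ 2) * p x * χ x := by
    have hc : ((h2'.toSchwartzMap h1' : 𝓢(ℝ, ℂ)) : ℝ → ℂ) = fun x => (χ x : ℂ) := rfl
    rw [hc] at e
    simp only [hd, ← Complex.ofReal_mul] at e
    rw [integral_complex_ofReal, integral_complex_ofReal] at e
    exact_mod_cast e
  have i1 : Integrable (fun x => χ x * p' x) := by
    simpa using hp'int.integrable_smul_left_of_hasCompactSupport h1.continuous h2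
  have i2 : Integrable (fun x => 2 * x / (1 + x ^ 2) * p x * χ x) :=
    (hgc.mul h1.continuous).integrable_of_hasCompactSupport h2.mul_left
  calc _ = ∫ x, χ x * p' x + 2 * x / (1 + x ^ 2) * p x * χ x := by
        congr 1; ext x; simp; ring
    _ = 0 := by
        rw [integral_add i1 i2, ← e3, e2]; ring

/-- Characterization: if a real random variable has an absolutely continuous density `p`
(with a.e. derivative `p'` in the sense of the fundamental theorem of calculus),
satisfies the moment condition `E[|X|/(1+X²)] < ∞`, and
`E[(it - 2X/(1+X²)) exp(itX)] = 0` for all `t`, then `p` satisfies the ODE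
`p'(x) + (2x/(1+x²)) p(x) = 0` a.e., and `p` is the standard Cauchy density. -/
theorem cauchy_char_sufficiency (p p' : ℝ → ℝ)
    (hpos : ∀ x, 0 ≤ p x)
    (hac : ∀ a b : ℝ, p b - p a = ∫ x in a..b, p' x)
    (hp'int : LocallyIntegrable p' volume)
    (hint : Integrable p volume)
    (hnorm : ∫ x : ℝ, p x = 1)
    (hmom : Integrable (fun x : ℝ => |x| / (1 + x ^ 2) * p x) volume)
    (hchar : ∀ t : ℝ,
      ∫ x : ℝ, ((Complex.I * t - 2 * x / (1 + (x : ℂ) ^ 2)) * Complex.exp (Complex.I * t * x))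
        * (p x : ℂ) = 0) :
    (∀ᵐ x : ℝ, p' x + 2 * x / (1 + x ^ 2) * p x = 0) ∧
      ∀ x : ℝ, p x = 1 / (π * (1 + x ^ 2)) := by
  have hcont : Continuous p := by
    have hpe : p = fun x => (∫ t in (0 : ℝ)..x, p' t) + p 0 := by
      ext x
      linarith [hac 0 x]
    rw [hpe]
    refine (intervalIntegral.continuous_primitive (fun u v => ?_) _).add continuous_const
    exact (hp'int.integrableOn_isCompact isCompact_uIcc).intervalIntegrable
  have hode := aux_ode p p' hcont hac hp'int hint hmom hchar
  refine ⟨hode, ?_⟩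
  have hne : ∀ x : ℝ, 1 + x ^ 2 ≠ 0 := fun x => by positivity
  have hgc : Continuous (fun x : ℝ => -(2 * x / (1 + x ^ 2) * p x)) :=
    ((Continuous.div (by fun_prop) (by fun_prop) hne).mul hcont).neg
  have hpe : p = fun x => (∫ t in (0 : ℝ)..x, -(2 * t / (1 + t ^ 2) * p t)) + p 0 := by
    ext x
    have : ∫ t in (0 : ℝ)..x, -(2 * t / (1 + t ^ 2) * p t) = ∫ t in (0 : ℝ)..x, p' t := by
      apply intervalIntegral.integral_congr_ae
      filter_upwards [hode] with t ht _
      linarith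
    linarith [hac 0 x]
  have hder : ∀ x, HasDerivAt p (-(2 * x / (1 + x ^ 2) * p x)) x := by
    intro x
    have := (hgc.integral_hasStrictDerivAt 0 x).hasDerivAt.add_const (p 0)
    exact this.congr_of_eventuallyEq (Filter.Eventually.of_forall fun y => congrFun hpe y)
  have hq : ∀ x, HasDerivAt (fun x => (1 + x ^ 2) * p x) 0 x := by
    intro x
    have h1 : HasDerivAt (fun x : ℝ => 1 + x ^ 2) (2 * x) x := by
      simpa using (hasDerivAt_pow 2 x).const_add 1
    convert! h1.mul (hder x) using 1
    have := hne x
    field_simp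
    ring
  have hconst : ∀ x, (1 + x ^ 2) * p x = p 0 := by
    intro x
    have := is_const_of_deriv_eq_zero (fun y => (hq y).differentiableAt)
      (fun y => (hq y).deriv) x 0
    simpa using this
  have hp : ∀ x, p x = p 0 * (1 + x ^ 2)⁻¹ := by
    intro x
    rw [← hconst x]
    field_simp
  have hc : p 0 * π = 1 := by
    rw [← hnorm, ← integral_univ_inv_one_add_sq, ← integral_const_mul]
    exact integral_congr_ae (Filter.Eventually.of_forall fun x => (hp x).symm)
  intro x
  have := hne x
  rw [hp x, eq_div_of_mul_eq pi_ne_zero hc]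
  field_simp
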